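/- Let S be a finite set of n pairwise distinct trajectories, let 1 ≤ k ≤ n, and let 𝒞* be an SD-optimal k-clustering of S all of whose clusters are nonempty. Then 𝒞* is defined by a hole-cluster sequence: there exist partitions 𝒫₀, 𝒫₁, …, 𝒫_{k−1} of S such that 𝒫₀ = {S}, 𝒫_{k−1} equals the set of clusters of 𝒞*, and for each 1 ≤ i ≤ k−1 there exist a cluster C ∈ 𝒫_{i−1} and a hole h of S with h ⊆ cspan(C) such that 𝒫_i = (𝒫_{i−1} ∖ {C}) ∪ {C ∩ S_ℓ(h), C ∩ S_r(h)}. -/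

import Mathlib

noncomputable section

/-- Position at time `t` of the trajectory `(a, v)`, i.e. `a + v*t`. -/
def trajPos (s : ℝ × ℝ) (t : ℝ) : ℝ := s.1 + s.2 * t

/-- Diameter of a finite set of trajectories: the integral over `[0,1]` of the
width of the set of positions; `0` for the empty set. -/
noncomputable def kdiam (C : Finset (ℝ × ℝ)) : ℝ :=
  if h : C.Nonempty then
    ∫ t in (0:ℝ)..1,
      (C.sup' h (fun s => trajPos s t) - C.inf' h (fun s => trajPos s t))
  else 0

/-- A `k`-clustering of `S`: pairwise disjoint (possibly empty) clusters
indexed by `Fin k` whose union is `S`. -/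
def IsClustering (S : Finset (ℝ × ℝ)) (k : ℕ) (𝒞 : Fin k → Finset (ℝ × ℝ)) : Prop :=
  (∀ i j : Fin k, i ≠ j → Disjoint (𝒞 i) (𝒞 j)) ∧
  Finset.univ.biUnion 𝒞 = S

/-- Sum of the diameters of the clusters. -/
noncomputable def sd {k : ℕ} (𝒞 : Fin k → Finset (ℝ × ℝ)) : ℝ :=
  ∑ i, kdiam (𝒞 i)

/-- Maximum diameter of a cluster. -/
noncomputable def md {k : ℕ} (𝒞 : Fin k → Finset (ℝ × ℝ)) : ℝ :=
  ⨆ i, kdiam (𝒞 i)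

/-- An SD-optimal `k`-clustering: minimizes `sd` among all `k`-clusterings of `S`. -/
def SDOptimal (S : Finset (ℝ × ℝ)) (k : ℕ) (𝒞 : Fin k → Finset (ℝ × ℝ)) : Prop :=
  IsClustering S k 𝒞 ∧
  ∀ 𝒟 : Fin k → Finset (ℝ × ℝ), IsClustering S k 𝒟 → sd 𝒞 ≤ sd 𝒟

/-- Optimal value of the maximum diameter over all `k`-clusterings of `S`. -/
noncomputable def optmd (S : Finset (ℝ × ℝ)) (k : ℕ) : ℝ :=
  sInf {x | ∃ 𝒞 : Fin k → Finset (ℝ × ℝ), IsClustering S k 𝒞 ∧ x = md 𝒞}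

/-- The strip `{(x,t) : 0 ≤ t ≤ 1}`. -/
def strip : Set (ℝ × ℝ) := {p | 0 ≤ p.2 ∧ p.2 ≤ 1}

/-- The graph of a trajectory inside the strip. -/
def trajGraph (s : ℝ × ℝ) : Set (ℝ × ℝ) :=
  {p | 0 ≤ p.2 ∧ p.2 ≤ 1 ∧ p.1 = trajPos s p.2}

/-- The strip minus the union of the graphs of the trajectories of `S`. -/
def freeRegion (S : Finset (ℝ × ℝ)) : Set (ℝ × ℝ) :=
  strip \ ⋃ s ∈ S, trajGraph s

/-- A hole of `S`: a connected component of the strip minus the graphs. -/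
def IsHole (S : Finset (ℝ × ℝ)) (h : Set (ℝ × ℝ)) : Prop :=
  ∃ p ∈ freeRegion S, h = connectedComponentIn (freeRegion S) p

/-- `s` is to the left of the hole `h`. -/
def LeftOf (s : ℝ × ℝ) (h : Set (ℝ × ℝ)) : Prop :=
  ∃ p ∈ h, trajPos s p.2 < p.1

open Classical in
/-- The trajectories of `S` to the left of `h`. -/
noncomputable def Sleft (S : Finset (ℝ × ℝ)) (h : Set (ℝ × ℝ)) : Finset (ℝ × ℝ) :=
  S.filter (fun s => LeftOf s h)

open Classical in
/-- The trajectories of `S` to the right of `h`. -/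
noncomputable def Sright (S : Finset (ℝ × ℝ)) (h : Set (ℝ × ℝ)) : Finset (ℝ × ℝ) :=
  S.filter (fun s => ¬ LeftOf s h)

/-- The hole `h` separates the clusters `A` and `B`. -/
def Separates (S : Finset (ℝ × ℝ)) (h : Set (ℝ × ℝ))
    (A B : Finset (ℝ × ℝ)) : Prop :=
  (A ⊆ Sleft S h ∧ B ⊆ Sright S h) ∨ (B ⊆ Sleft S h ∧ A ⊆ Sright S h)

/-- The span of a cluster: the region of the strip between its left and right sides. -/
noncomputable def cspan (C : Finset (ℝ × ℝ)) : Set (ℝ × ℝ) :=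
  if h : C.Nonempty then
    {p | 0 ≤ p.2 ∧ p.2 ≤ 1 ∧
      C.inf' h (fun s => trajPos s p.2) ≤ p.1 ∧
      p.1 ≤ C.sup' h (fun s => trajPos s p.2)}
  else ∅

/-- A hole is covered by a clustering if it is contained in the span of some cluster. -/
def Covered {k : ℕ} (𝒞 : Fin k → Finset (ℝ × ℝ)) (h : Set (ℝ × ℝ)) : Prop :=
  ∃ i, h ⊆ cspan (𝒞 i)

/-- A well-separated clustering: every two distinct nonempty clusters are
separated by some uncovered hole. -/
def WellSeparated (S : Finset (ℝ × ℝ)) (k : ℕ)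
    (𝒞 : Fin k → Finset (ℝ × ℝ)) : Prop :=
  IsClustering S k 𝒞 ∧
  ∀ i j : Fin k, i ≠ j → (𝒞 i).Nonempty → (𝒞 j).Nonempty →
    ∃ h, IsHole S h ∧ ¬ Covered 𝒞 h ∧ Separates S h (𝒞 i) (𝒞 j)

end

lemma continuous_trajPos (s : ℝ × ℝ) : Continuous (trajPos s) := by
  unfold trajPos; fun_prop

lemma finite_setOf_trajPos_eq {s r : ℝ × ℝ} (h : s ≠ r) :
    {t | trajPos s t = trajPos r t}.Finite := by
  refine Set.Subsingleton.finite fun t ht u hu => ?_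
  simp only [trajPos, Set.mem_ofPred_eq] at ht hu
  by_contra htu
  have hv : s.2 = r.2 := by
    have : (s.2 - r.2) * (t - u) = 0 := by linarith
    rcases mul_eq_zero.mp this with h' | h'
    · linarith
    · exact absurd (sub_eq_zero.mp h') htu
  refine h (Prod.ext ?_ hv)
  rw [hv] at ht
  linarith

/-- At some time in the unit interval all trajectories of `U` have distinct positions. -/
lemma exists_injOn_trajPos (U : Finset (ℝ × ℝ)) :
    ∃ t ∈ Set.Icc (0 : ℝ) 1, Set.InjOn (fun s => trajPos s t) U := by
  have hfin : (⋃ p ∈ U.offDiag, {t | trajPos p.1 t = trajPos p.2 t}).Finite :=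
    U.offDiag.finite_toSet.biUnion fun p hp =>
      finite_setOf_trajPos_eq (Finset.mem_offDiag.mp hp).2.2
  obtain ⟨t, ht, hbad⟩ := (Set.Icc_infinite (zero_lt_one' ℝ)).exists_notMem_finite hfin
  refine ⟨t, ht, fun s hs r hr hsr => ?_⟩
  by_contra hne
  exact hbad (Set.mem_biUnion (x := (s, r)) (Finset.mem_offDiag.mpr ⟨hs, hr, hne⟩) hsr)

lemma continuous_sup'_sub_inf' {C : Finset (ℝ × ℝ)} (h : C.Nonempty) :
    Continuous fun t => C.sup' h (fun s => trajPos s t) - C.inf' h (fun s => trajPos s t) :=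
  (Continuous.finset_sup'_apply h fun s _ => continuous_trajPos s).sub
    (Continuous.finset_inf'_apply h fun s _ => continuous_trajPos s)

lemma kdiam_singleton (s : ℝ × ℝ) : kdiam {s} = 0 := by
  simp [kdiam]

/-- Removing a suitable trajectory strictly decreases the diameter. -/
lemma exists_kdiam_erase_lt {U : Finset (ℝ × ℝ)} (hU : 1 < U.card) :
    ∃ s ∈ U, kdiam (U.erase s) < kdiam U := by
  obtain ⟨t, ht, hinj⟩ := exists_injOn_trajPos U
  have hne : U.Nonempty := Finset.card_pos.mp (by omega)
  obtain ⟨s, hs, hmax⟩ := U.exists_max_image (fun s => trajPos s t) hne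
  have hne' : (U.erase s).Nonempty := by
    rw [← Finset.card_pos, Finset.card_erase_of_mem hs]; omega
  refine ⟨s, hs, ?_⟩
  rw [kdiam, kdiam, dif_pos hne, dif_pos hne']
  have hsub := Finset.erase_subset s U
  refine intervalIntegral.integral_lt_integral_of_continuousOn_of_le_of_exists_lt zero_lt_one
    (continuous_sup'_sub_inf' hne').continuousOn (continuous_sup'_sub_inf' hne).continuousOn
    (fun u _ => sub_le_sub (Finset.sup'_mono _ hsub hne') (Finset.inf'_mono _ hsub hne'))
    ⟨t, ht, (sub_lt_sub_right ?_ _).trans_le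
      (sub_le_sub_left (Finset.inf'_mono _ hsub hne') _)⟩
  refine lt_of_lt_of_le ((Finset.sup'_lt_iff _).mpr fun r hr => ?_)
    (Finset.le_sup' (fun s => trajPos s t) hs)
  obtain ⟨hrs, hr⟩ := Finset.mem_erase.mp hr
  exact lt_of_le_of_ne (hmax r hr) fun h => hrs (hinj hr hs h)

/-- If the spans of the clusters cover the span of their union, the diameters are subadditive. -/
lemma kdiam_biUnion_le {ι : Type*} (I : Finset ι) (𝒞 : ι → Finset (ℝ × ℝ))
    (hne : ∀ i, (𝒞 i).Nonempty) (hcov : cspan (I.biUnion 𝒞) ⊆ ⋃ i ∈ I, cspan (𝒞 i)) :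
    kdiam (I.biUnion 𝒞) ≤ ∑ i ∈ I, kdiam (𝒞 i) := by
  by_cases hU : (I.biUnion 𝒞).Nonempty
  swap
  · have : ∀ i ∈ I, 0 ≤ kdiam (𝒞 i) := fun i hi =>
      absurd ((hne i).mono (Finset.subset_biUnion_of_mem 𝒞 hi)) hU
    simpa [kdiam, hU] using Finset.sum_nonneg this
  simp only [kdiam, dif_pos hU, dif_pos (hne _)]
  rw [← intervalIntegral.integral_finsetSum fun i _ =>
    (continuous_sup'_sub_inf' (hne i)).intervalIntegrable _ _]
  refine intervalIntegral.integral_mono_on zero_le_one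
    ((continuous_sup'_sub_inf' hU).intervalIntegrable _ _)
    ((continuous_finsetSum _ fun i _ =>
      continuous_sup'_sub_inf' (hne i)).intervalIntegrable _ _) fun t ht => ?_
  set lo := fun i => (𝒞 i).inf' (hne i) fun s => trajPos s t
  set hi := fun i => (𝒞 i).sup' (hne i) fun s => trajPos s t
  have hlohi : ∀ i, lo i ≤ hi i := fun i =>
    (Finset.inf'_le _ (hne i).choose_spec).trans (Finset.le_sup' (fun s => trajPos s t)
      (hne i).choose_spec)
  have hsub : Set.Icc ((I.biUnion 𝒞).inf' hU fun s => trajPos s t)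
      ((I.biUnion 𝒞).sup' hU fun s => trajPos s t) ⊆ ⋃ i ∈ I, Set.Icc (lo i) (hi i) := by
    intro x hx
    have hmem : (x, t) ∈ cspan (I.biUnion 𝒞) := by
      rw [cspan, dif_pos hU]; exact ⟨ht.1, ht.2, hx.1, hx.2⟩
    obtain ⟨i, hiI, hmem⟩ := Set.mem_iUnion₂.mp (hcov hmem)
    rw [cspan, dif_pos (hne i)] at hmem
    exact Set.mem_biUnion hiI ⟨hmem.2.2.1, hmem.2.2.2⟩
  have hvol := (MeasureTheory.measure_mono (μ := MeasureTheory.volume) hsub).trans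
    (MeasureTheory.measure_biUnion_finset_le I _)
  simp only [Real.volume_Icc] at hvol
  rw [← ENNReal.ofReal_sum_of_nonneg fun i _ => sub_nonneg.mpr (hlohi i)] at hvol
  exact (ENNReal.ofReal_le_ofReal_iff
    (Finset.sum_nonneg fun i _ => sub_nonneg.mpr (hlohi i))).mp hvol

/-- In an optimal clustering, the spans of two or more clusters do not cover the span of
their union. -/
lemma SDOptimal.not_cspan_biUnion_subset {S : Finset (ℝ × ℝ)} {k : ℕ}
    {𝒞 : Fin k → Finset (ℝ × ℝ)} (hopt : SDOptimal S k 𝒞) (hne : ∀ i, (𝒞 i).Nonempty)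
    {I : Finset (Fin k)} (hI : 1 < I.card) :
    ¬ cspan (I.biUnion 𝒞) ⊆ ⋃ i ∈ I, cspan (𝒞 i) := by
  intro hcov
  obtain ⟨⟨hdisj, hunion⟩, hmin⟩ := hopt
  obtain ⟨i, hi, j, hj, hij⟩ := Finset.one_lt_card.mp hI
  set U := I.biUnion 𝒞 with hUdef
  have hUcard : 1 < U.card := by
    obtain ⟨x, hx⟩ := hne i
    obtain ⟨y, hy⟩ := hne j
    refine Finset.one_lt_card.mpr ⟨x, Finset.mem_biUnion.mpr ⟨i, hi, hx⟩, y,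
      Finset.mem_biUnion.mpr ⟨j, hj, hy⟩, ?_⟩
    exact Finset.disjoint_iff_ne.mp (hdisj i j hij) x hx y hy
  obtain ⟨s, hs, hlt⟩ := exists_kdiam_erase_lt hUcard
  have hle := kdiam_biUnion_le I 𝒞 hne hcov
  have hUout : ∀ l, l ∉ I → Disjoint (𝒞 l) U := fun l hl =>
    (Finset.disjoint_biUnion_right _ _ _).mpr fun m hm =>
      hdisj l m fun h => hl (h ▸ hm)
  let D : Fin k → Finset (ℝ × ℝ) := fun l =>
    if l ∈ I then (if l = i then U.erase s else if l = j then {s} else ∅) else 𝒞 l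
  have hDi : D i = U.erase s := by simp [D, hi]
  have hDj : D j = {s} := by simp [D, hj, hij.symm]
  have hD0 : ∀ l ∈ I, l ≠ i → l ≠ j → D l = ∅ := fun l hl h1 h2 => by simp [D, hl, h1, h2]
  have hDout : ∀ l, l ∉ I → D l = 𝒞 l := fun l hl => by simp [D, hl]
  have hDU : ∀ l ∈ I, D l ⊆ U := by
    intro l hl
    by_cases h1 : l = i
    · rw [h1, hDi]; exact Finset.erase_subset _ _
    by_cases h2 : l = j
    · rw [h2, hDj]; simpa using hs
    · rw [hD0 l hl h1 h2]; exact Finset.empty_subset _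
  have hDmem : ∀ l ∈ I, ∀ x ∈ D l, (x = s → l = j) ∧ (x ≠ s → l = i) := by
    intro l hl x hx
    by_cases h1 : l = i
    · rw [h1, hDi] at hx
      exact ⟨fun h => absurd h (Finset.ne_of_mem_erase hx), fun _ => h1⟩
    by_cases h2 : l = j
    · rw [h2, hDj] at hx
      exact ⟨fun _ => h2, fun h => absurd (Finset.mem_singleton.mp hx) h⟩
    · rw [hD0 l hl h1 h2] at hx
      exact absurd hx (Finset.notMem_empty x)
  have hclus : IsClustering S k D := by
    constructor
    · intro l m hlm
      by_cases hl : l ∈ I <;> by_cases hm : m ∈ I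
      · refine Finset.disjoint_left.mpr fun x hxl hxm => hlm ?_
        by_cases hxs : x = s
        · rw [(hDmem l hl x hxl).1 hxs, (hDmem m hm x hxm).1 hxs]
        · rw [(hDmem l hl x hxl).2 hxs, (hDmem m hm x hxm).2 hxs]
      · rw [hDout m hm]; exact ((hUout m hm).mono_right (hDU l hl)).symm
      · rw [hDout l hl]; exact (hUout l hl).mono_right (hDU m hm)
      · rw [hDout l hl, hDout m hm]; exact hdisj l m hlm
    · rw [← hunion]
      ext x
      simp only [Finset.mem_biUnion, Finset.mem_univ, true_and]
      constructor
      · rintro ⟨l, hx⟩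
        by_cases hl : l ∈ I
        · obtain ⟨m, -, hm⟩ := Finset.mem_biUnion.mp (hDU l hl hx)
          exact ⟨m, hm⟩
        · exact ⟨l, hDout l hl ▸ hx⟩
      · rintro ⟨l, hx⟩
        by_cases hl : l ∈ I
        · by_cases hxs : x = s
          · exact ⟨j, by simp [hDj, hxs]⟩
          · exact ⟨i, by
              rw [hDi]
              exact Finset.mem_erase.mpr ⟨hxs, Finset.mem_biUnion.mpr ⟨l, hl, hx⟩⟩⟩
        · exact ⟨l, by rwa [hDout l hl]⟩
  have hsum : ∑ l ∈ I, kdiam (D l) = kdiam (U.erase s) := by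
    rw [Finset.sum_eq_single i, hDi]
    · intro l hl hli
      by_cases h2 : l = j
      · rw [h2, hDj, kdiam_singleton]
      · rw [hD0 l hl hli h2]; simp [kdiam]
    · exact fun h => absurd hi h
  have hrest : ∑ l ∈ Iᶜ, kdiam (D l) = ∑ l ∈ Iᶜ, kdiam (𝒞 l) :=
    Finset.sum_congr rfl fun l hl => by rw [hDout l (Finset.mem_compl.mp hl)]
  have h1 := hmin D hclus
  rw [sd, sd, ← Finset.sum_add_sum_compl I, ← Finset.sum_add_sum_compl I (fun l => kdiam (D l)),
    hsum, hrest] at h1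
  linarith

/-- A preconnected region of the strip avoiding the graph of `s` lies on one side of it. -/
lemma trajPos_lt_iff_of_isPreconnected {h : Set (ℝ × ℝ)} (hconn : IsPreconnected h)
    {s : ℝ × ℝ} (havoid : ∀ q ∈ h, q.1 ≠ trajPos s q.2) {p q : ℝ × ℝ} (hp : p ∈ h)
    (hq : q ∈ h) (hlt : trajPos s p.2 < p.1) : trajPos s q.2 < q.1 := by
  by_contra hle
  have hcont : Continuous fun r : ℝ × ℝ => r.1 - trajPos s r.2 :=
    continuous_fst.sub ((continuous_trajPos s).comp continuous_snd)
  obtain ⟨r, hr, h0⟩ := hconn.intermediate_value hq hp hcont.continuousOn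
    (show (0 : ℝ) ∈ Set.Icc _ _ from ⟨by simpa using hle, by simpa using hlt.le⟩)
  exact havoid r hr (sub_eq_zero.mp h0)

lemma leftOf_hole_iff {S : Finset (ℝ × ℝ)} {p s : ℝ × ℝ} (hs : s ∈ S)
    {q : ℝ × ℝ} (hq : q ∈ connectedComponentIn (freeRegion S) p) :
    LeftOf s (connectedComponentIn (freeRegion S) p) ↔ trajPos s q.2 < q.1 := by
  have havoid : ∀ r ∈ connectedComponentIn (freeRegion S) p, r.1 ≠ trajPos s r.2 := by
    intro r hr heq
    obtain ⟨hstrip, hfree⟩ := connectedComponentIn_subset _ _ hr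
    exact hfree (Set.mem_biUnion hs ⟨hstrip.1, hstrip.2, heq⟩)
  constructor
  · rintro ⟨r, hr, hlt⟩
    exact trajPos_lt_iff_of_isPreconnected isPreconnected_connectedComponentIn havoid hr hq hlt
  · exact fun hlt => ⟨q, hq, hlt⟩

/-- A point of the span of a union of clusters outside the spans of the individual clusters can
be moved off the graphs. -/
lemma exists_mem_freeRegion {ι : Type*} (S : Finset (ℝ × ℝ)) (I : Finset ι)
    {𝒞 : ι → Finset (ℝ × ℝ)} (hne : ∀ i, (𝒞 i).Nonempty)
    (hcov : ¬ cspan (I.biUnion 𝒞) ⊆ ⋃ i ∈ I, cspan (𝒞 i)) :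
    ∃ p ∈ freeRegion S,
      (∃ i ∈ I, ∀ s ∈ 𝒞 i, trajPos s p.2 < p.1) ∧ (∃ i ∈ I, ∀ s ∈ 𝒞 i, p.1 < trajPos s p.2) ∧
      ∀ i ∈ I, (∀ s ∈ 𝒞 i, trajPos s p.2 < p.1) ∨ ∀ s ∈ 𝒞 i, p.1 < trajPos s p.2 := by
  obtain ⟨⟨x, t⟩, hmem, hout⟩ := Set.not_subset.mp hcov
  have hU : (I.biUnion 𝒞).Nonempty := by
    by_contra hU
    simp [cspan, hU] at hmem
  rw [cspan, dif_pos hU] at hmem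
  obtain ⟨ht0, ht1, hlo, hhi⟩ := hmem
  simp only at ht0 ht1 hlo hhi
  have hside : ∀ i ∈ I, (∀ s ∈ 𝒞 i, trajPos s t < x) ∨ ∀ s ∈ 𝒞 i, x < trajPos s t := by
    intro i hi
    have hnot : (x, t) ∉ cspan (𝒞 i) := fun h => hout (Set.mem_biUnion hi h)
    rw [cspan, dif_pos (hne i)] at hnot
    by_cases hlt : (𝒞 i).sup' (hne i) (fun s => trajPos s t) < x
    · exact Or.inl ((Finset.sup'_lt_iff _).mp hlt)
    · refine Or.inr ((Finset.lt_inf'_iff (hne i)).mp ?_)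
      by_contra hge
      exact hnot ⟨ht0, ht1, not_lt.mp hge, not_lt.mp hlt⟩
  have hopen : IsOpen {y | ∀ s ∈ I.biUnion 𝒞,
      (trajPos s t < x → trajPos s t < y) ∧ (x < trajPos s t → y < trajPos s t)} := by
    simp only [Set.ofPred_forall, Set.ofPred_and]
    refine isOpen_biInter_finset fun s _ => IsOpen.inter ?_ ?_
    · by_cases h : trajPos s t < x <;> simp [h]
      exact isOpen_Ioi
    · by_cases h : x < trajPos s t <;> simp [h]
      exact isOpen_Iio
  obtain ⟨y, hy, hyS⟩ := (infinite_of_mem_nhds x (hopen.mem_nhds fun s _ =>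
    ⟨id, id⟩)).exists_notMem_finite (S.image fun s => trajPos s t).finite_toSet
  have hL : ∀ i ∈ I, (∀ s ∈ 𝒞 i, trajPos s t < x) → ∀ s ∈ 𝒞 i, trajPos s t < y :=
    fun i hi h s hs => (hy s (Finset.mem_biUnion.mpr ⟨i, hi, hs⟩)).1 (h s hs)
  have hR : ∀ i ∈ I, (∀ s ∈ 𝒞 i, x < trajPos s t) → ∀ s ∈ 𝒞 i, y < trajPos s t :=
    fun i hi h s hs => (hy s (Finset.mem_biUnion.mpr ⟨i, hi, hs⟩)).2 (h s hs)
  refine ⟨(y, t), ⟨⟨ht0, ht1⟩, fun hg => ?_⟩, ?_, ?_, fun i hi =>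
    (hside i hi).imp (hL i hi) (hR i hi)⟩
  · obtain ⟨s, hs, hgs⟩ := Set.mem_iUnion₂.mp hg
    exact hyS (Finset.mem_coe.mpr (Finset.mem_image.mpr ⟨s, hs, hgs.2.2.symm⟩))
  · obtain ⟨s, hs, hle⟩ := (Finset.inf'_le_iff hU).mp hlo
    obtain ⟨i, hi, hsi⟩ := Finset.mem_biUnion.mp hs
    exact ⟨i, hi, hL i hi ((hside i hi).resolve_right fun h => absurd (h s hsi) hle.not_gt)⟩
  · obtain ⟨s, hs, hle⟩ := (Finset.le_sup'_iff hU).mp hhi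
    obtain ⟨i, hi, hsi⟩ := Finset.mem_biUnion.mp hs
    exact ⟨i, hi, hR i hi ((hside i hi).resolve_left fun h => absurd (h s hsi) hle.not_gt)⟩

/-- Any group of two or more clusters of an optimal clustering is split by a hole in the span of
their union. -/
lemma SDOptimal.exists_hole_split {S : Finset (ℝ × ℝ)} {k : ℕ}
    {𝒞 : Fin k → Finset (ℝ × ℝ)} (hopt : SDOptimal S k 𝒞) (hne : ∀ i, (𝒞 i).Nonempty)
    {I : Finset (Fin k)} (hI : 1 < I.card) :
    ∃ h, IsHole S h ∧ h ⊆ cspan (I.biUnion 𝒞) ∧ ∃ L R : Finset (Fin k),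
      L.Nonempty ∧ R.Nonempty ∧ Disjoint L R ∧ L ∪ R = I ∧
      I.biUnion 𝒞 ∩ Sleft S h = L.biUnion 𝒞 ∧ I.biUnion 𝒞 ∩ Sright S h = R.biUnion 𝒞 := by
  classical
  obtain ⟨p, hp, ⟨i, hi, hil⟩, ⟨j, hj, hjr⟩, hside⟩ :=
    exists_mem_freeRegion S I hne (hopt.not_cspan_biUnion_subset hne hI)
  have hS : ∀ l, ∀ s ∈ 𝒞 l, s ∈ S := fun l s hs =>
    hopt.1.2 ▸ Finset.mem_biUnion.mpr ⟨l, Finset.mem_univ _, hs⟩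
  have hpmem : p ∈ connectedComponentIn (freeRegion S) p := mem_connectedComponentIn hp
  obtain ⟨a, ha⟩ := hne i
  obtain ⟨b, hb⟩ := hne j
  have hleft : ∀ l, ∀ s ∈ 𝒞 l,
      (LeftOf s (connectedComponentIn (freeRegion S) p) ↔ trajPos s p.2 < p.1) :=
    fun l s hs => leftOf_hole_iff (hS l s hs) hpmem
  refine ⟨_, ⟨p, hp, rfl⟩, fun q hq => ?_, I.filter fun l => ∀ s ∈ 𝒞 l, trajPos s p.2 < p.1,
    I.filter fun l => ¬ ∀ s ∈ 𝒞 l, trajPos s p.2 < p.1, ⟨i, Finset.mem_filter.mpr ⟨hi, hil⟩⟩,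
    ⟨j, Finset.mem_filter.mpr ⟨hj, fun h => (h b hb).not_gt (hjr b hb)⟩⟩,
    Finset.disjoint_filter_filter_not _ _ _, Finset.filter_union_filter_not_eq _ _, ?_, ?_⟩
  · have haU := Finset.mem_biUnion.mpr ⟨i, hi, ha⟩
    have hbU := Finset.mem_biUnion.mpr ⟨j, hj, hb⟩
    rw [cspan, dif_pos ⟨a, haU⟩]
    obtain ⟨hstrip, -⟩ := connectedComponentIn_subset _ _ hq
    refine ⟨hstrip.1, hstrip.2, (Finset.inf'_le _ haU).trans ?_,
      le_trans ?_ (Finset.le_sup' (fun s => trajPos s q.2) hbU)⟩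
    · exact ((leftOf_hole_iff (hS i a ha) hq).mp ((hleft i a ha).mpr (hil a ha))).le
    · refine not_lt.mp fun hlt => (hjr b hb).not_gt ((hleft j b hb).mp ?_)
      exact (leftOf_hole_iff (hS j b hb) hq).mpr hlt
  · ext s
    simp only [Finset.mem_inter, Finset.mem_biUnion, Sleft, Finset.mem_filter]
    constructor
    · rintro ⟨⟨l, hl, hsl⟩, -, hlo⟩
      exact ⟨l, ⟨hl, (hside l hl).resolve_right fun h =>
        (h s hsl).not_gt ((hleft l s hsl).mp hlo)⟩, hsl⟩
    · rintro ⟨l, ⟨hl, hall⟩, hsl⟩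
      exact ⟨⟨l, hl, hsl⟩, hS l s hsl, (hleft l s hsl).mpr (hall s hsl)⟩
  · ext s
    simp only [Finset.mem_inter, Finset.mem_biUnion, Sright, Finset.mem_filter]
    constructor
    · rintro ⟨⟨l, hl, hsl⟩, -, hlo⟩
      exact ⟨l, ⟨hl, fun h => hlo ((hleft l s hsl).mpr (h s hsl))⟩, hsl⟩
    · rintro ⟨l, ⟨hl, hall⟩, hsl⟩
      exact ⟨⟨l, hl, hsl⟩, hS l s hsl, fun hlo =>
        (((hside l hl).resolve_left hall) s hsl).not_gt ((hleft l s hsl).mp hlo)⟩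

/-- `Q` is a partition of the index type into nonempty blocks. -/
structure IsBlockPartition {ι : Type*} (Q : Finset (Finset ι)) : Prop where
  nonempty : ∀ I ∈ Q, I.Nonempty
  disjoint : ∀ I ∈ Q, ∀ J ∈ Q, I ≠ J → Disjoint I J
  cover : ∀ i, ∃ I ∈ Q, i ∈ I

namespace IsBlockPartition

variable {ι : Type*} [DecidableEq ι] {Q : Finset (Finset ι)}

lemma sum_card [Fintype ι] (hQ : IsBlockPartition Q) : ∑ I ∈ Q, I.card = Fintype.card ι := by
  have h := Finset.card_biUnion (s := Q) (t := id) hQ.disjoint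
  have huniv : Q.biUnion id = Finset.univ := by
    ext i
    simpa using hQ.cover i
  rw [huniv] at h
  exact h.symm

lemma exists_one_lt_card [Fintype ι] (hQ : IsBlockPartition Q) (hlt : Q.card < Fintype.card ι) :
    ∃ I ∈ Q, 1 < I.card := by
  by_contra! h
  have := Finset.sum_le_card_nsmul Q Finset.card 1 h
  rw [hQ.sum_card] at this
  simp at this
  omega

lemma card_eq_one [Fintype ι] (hQ : IsBlockPartition Q) (heq : Q.card = Fintype.card ι) :
    ∀ I ∈ Q, I.card = 1 := by
  have h1 : ∀ I ∈ Q, 1 ≤ I.card := fun I hI => Finset.card_pos.mpr (hQ.nonempty I hI)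
  have h := (Finset.sum_eq_sum_iff_of_le h1).mp (by rw [hQ.sum_card]; simpa using heq)
  exact fun I hI => (h I hI).symm

lemma notMem_erase_of_subset (hQ : IsBlockPartition Q) {I L : Finset ι} (hI : I ∈ Q)
    (hL : L.Nonempty) (hLI : L ⊆ I) : L ∉ Q.erase I := by
  intro h
  obtain ⟨hne, hmem⟩ := Finset.mem_erase.mp h
  obtain ⟨x, hx⟩ := hL
  exact Finset.disjoint_left.mp (hQ.disjoint L hmem I hI hne) hx (hLI hx)

/-- Replacing a block by two complementary nonempty pieces. -/
lemma split (hQ : IsBlockPartition Q) {L R : Finset ι} (hI : L ∪ R ∈ Q) (hL : L.Nonempty)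
    (hR : R.Nonempty) (hLR : Disjoint L R) :
    IsBlockPartition (insert L (insert R (Q.erase (L ∪ R)))) ∧
      (insert L (insert R (Q.erase (L ∪ R)))).card = Q.card + 1 := by
  have hout : ∀ J ∈ Q.erase (L ∪ R), Disjoint L J ∧ Disjoint R J := by
    intro J hJ
    obtain ⟨hne, hJ⟩ := Finset.mem_erase.mp hJ
    exact Finset.disjoint_union_left.mp (hQ.disjoint _ hI J hJ hne.symm)
  refine ⟨⟨?_, ?_, fun i => ?_⟩, ?_⟩
  · intro J hJ
    rcases Finset.mem_insert.mp hJ with rfl | hJ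
    · exact hL
    rcases Finset.mem_insert.mp hJ with rfl | hJ
    · exact hR
    · exact hQ.nonempty J (Finset.mem_of_mem_erase hJ)
  · intro J hJ K hK hne
    simp only [Finset.mem_insert] at hJ hK
    rcases hJ with rfl | rfl | hJ <;> rcases hK with rfl | rfl | hK
    · exact absurd rfl hne
    · exact hLR
    · exact (hout K hK).1
    · exact hLR.symm
    · exact absurd rfl hne
    · exact (hout K hK).2
    · exact (hout J hJ).1.symm
    · exact (hout J hJ).2.symm
    · exact hQ.disjoint J (Finset.mem_of_mem_erase hJ) K (Finset.mem_of_mem_erase hK) hne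
  · obtain ⟨J, hJ, hiJ⟩ := hQ.cover i
    by_cases h : J = L ∪ R
    · rcases Finset.mem_union.mp (h ▸ hiJ) with hi | hi
      · exact ⟨L, by simp, hi⟩
      · exact ⟨R, by simp, hi⟩
    · exact ⟨J, by simp [h, hJ], hiJ⟩
  · have hRn := hQ.notMem_erase_of_subset hI hR Finset.subset_union_right
    have hLn : L ∉ insert R (Q.erase (L ∪ R)) := by
      rw [Finset.mem_insert, not_or]
      refine ⟨fun h => hL.ne_empty ?_, hQ.notMem_erase_of_subset hI hL Finset.subset_union_left⟩
      rw [← h] at hLR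
      exact disjoint_self.mp hLR
    rw [Finset.card_insert_of_notMem hLn, Finset.card_insert_of_notMem hRn,
      Finset.card_erase_of_mem hI]
    have := Finset.card_pos.mpr ⟨_, hI⟩
    omega

end IsBlockPartition

lemma biUnion_injective_of_disjoint {ι α : Type*} [DecidableEq α] {𝒞 : ι → Finset α}
    (hdisj : ∀ i j, i ≠ j → Disjoint (𝒞 i) (𝒞 j)) (hne : ∀ i, (𝒞 i).Nonempty) :
    Function.Injective fun I : Finset ι => I.biUnion 𝒞 := by
  have key : ∀ I J : Finset ι, I.biUnion 𝒞 = J.biUnion 𝒞 → I ⊆ J := by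
    intro I J h i hi
    obtain ⟨x, hx⟩ := hne i
    have hxI : x ∈ I.biUnion 𝒞 := Finset.mem_biUnion.mpr ⟨i, hi, hx⟩
    rw [h] at hxI
    obtain ⟨j, hj, hxj⟩ := Finset.mem_biUnion.mp hxI
    by_contra hiJ
    exact Finset.disjoint_left.mp (hdisj i j fun h => hiJ (h ▸ hj)) hx hxj
  exact fun I J h => (key I J h).antisymm (key J I h.symm)

/-- every SD-optimal `k`-clustering with nonempty clusters is defined
by a hole-cluster sequence. -/
theorem stmt4 (S : Finset (ℝ × ℝ)) (k : ℕ) (hk1 : 1 ≤ k) (hkn : k ≤ S.card)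
    (𝒞 : Fin k → Finset (ℝ × ℝ)) (hopt : SDOptimal S k 𝒞)
    (hne : ∀ i, (𝒞 i).Nonempty) :
    ∃ Part : ℕ → Finset (Finset (ℝ × ℝ)),
      Part 0 = {S} ∧
      Part (k - 1) = Finset.univ.image 𝒞 ∧
      ∀ i, 1 ≤ i → i ≤ k - 1 →
        ∃ C ∈ Part (i - 1), ∃ h, IsHole S h ∧ h ⊆ cspan C ∧
          Part i = insert (C ∩ Sleft S h)
                  (insert (C ∩ Sright S h) ((Part (i - 1)).erase C)) := by
  have hinj := biUnion_injective_of_disjoint hopt.1.1 hne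
  set B : Finset (Fin k) → Finset (ℝ × ℝ) := fun I => I.biUnion 𝒞 with hB
  have hstep : ∀ Q : Finset (Finset (Fin k)), ∃ Q' : Finset (Finset (Fin k)),
      IsBlockPartition Q → Q.card < k → IsBlockPartition Q' ∧ Q'.card = Q.card + 1 ∧
        ∃ C ∈ Q.image B, ∃ h, IsHole S h ∧ h ⊆ cspan C ∧
          Q'.image B = insert (C ∩ Sleft S h)
            (insert (C ∩ Sright S h) ((Q.image B).erase C)) := by
    intro Q
    by_cases hQ : IsBlockPartition Q ∧ Q.card < k
    swap
    · exact ⟨Q, fun h1 h2 => absurd ⟨h1, h2⟩ hQ⟩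
    obtain ⟨I, hI, hcard⟩ := hQ.1.exists_one_lt_card (by simpa using hQ.2)
    obtain ⟨h, hhole, hspan, L, R, hL, hR, hLR, rfl, hl, hr⟩ := hopt.exists_hole_split hne hcard
    obtain ⟨hpart, hcard'⟩ := hQ.1.split hI hL hR hLR
    refine ⟨_, fun _ _ => ⟨hpart, hcard', _, Finset.mem_image_of_mem B hI, h, hhole, hspan, ?_⟩⟩
    rw [Finset.image_insert, Finset.image_insert, Finset.image_erase hinj, hl, hr]
  choose f hf using hstep
  have hinv : ∀ n, n ≤ k - 1 → IsBlockPartition (f^[n] {Finset.univ}) ∧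
      (f^[n] {Finset.univ}).card = n + 1 := by
    intro n
    induction n with
    | zero =>
      refine fun _ => ⟨⟨?_, ?_, fun i => ⟨Finset.univ, by simp, by simp⟩⟩, by simp⟩
      · intro I hI
        rw [Function.iterate_zero, id, Finset.mem_singleton] at hI
        exact ⟨⟨0, hk1⟩, by simp [hI]⟩
      · intro I hI J hJ hIJ
        rw [Function.iterate_zero, id, Finset.mem_singleton] at hI hJ
        exact absurd (hI.trans hJ.symm) hIJ
    | succ n ih =>
      intro hn
      obtain ⟨h1, h2⟩ := ih (by omega)
      obtain ⟨h3, h4, -⟩ := hf _ h1 (by omega)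
      rw [Function.iterate_succ_apply']
      exact ⟨h3, by omega⟩
  refine ⟨fun n => (f^[n] {Finset.univ}).image B, ?_, ?_, ?_⟩
  · simp [hB, hopt.1.2]
  · obtain ⟨h1, h2⟩ := hinv (k - 1) le_rfl
    have hone := h1.card_eq_one (by rw [h2, Fintype.card_fin]; omega)
    ext X
    simp only [Finset.mem_image, Finset.mem_univ, true_and]
    constructor
    · rintro ⟨I, hI, rfl⟩
      obtain ⟨i, rfl⟩ := Finset.card_eq_one.mp (hone I hI)
      exact ⟨i, by simp [hB]⟩
    · rintro ⟨i, rfl⟩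
      obtain ⟨I, hI, hi⟩ := h1.cover i
      obtain ⟨j, rfl⟩ := Finset.card_eq_one.mp (hone I hI)
      exact ⟨_, hI, by simp [hB, Finset.mem_singleton.mp hi]⟩
  · intro n hn hnk
    obtain ⟨m, rfl⟩ := Nat.exists_eq_add_of_le' hn
    obtain ⟨h1, h2⟩ := hinv m (by omega)
    obtain ⟨-, -, h3⟩ := hf _ h1 (by omega)
    simp only [Nat.add_sub_cancel, Function.iterate_succ_apply']
    exact h3
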